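/- (Value gap controlled by executability.) In a finite-horizon MDP with rewards in [0, R_max] and horizon H, let π_L be a policy and let π_gc be a policy such that for every state s there exist α(s) ∈ [0,1] and a probability mass function ρ_s on A with π_gc(a ∣ s) = α(s)·π_L(a ∣ s) + (1−α(s))·ρ_s(a) for all a. Then for any initial state s₀: V_H^{π_L}(s₀) − V_H^{π_gc}(s₀) ≤ 2·H·R_max · ∑_{t=0}^{H−1} E_{s∼d_{π_L,t}}[ 1 − α(s) ]. -/

import Mathlib

/-- A finite-horizon MDP with finite state and action spaces: a transition kernel `P`
(given as a probability mass function over next states), and a reward function `r`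
with values in `[0, Rmax]`. -/
structure FinMDP (S A : Type) [Fintype S] [Fintype A] where
  P : S → A → S → ℝ
  P_nonneg : ∀ s a s', 0 ≤ P s a s'
  P_sum : ∀ s a, ∑ s', P s a s' = 1
  r : S → A → ℝ
  Rmax : ℝ
  r_nonneg : ∀ s a, 0 ≤ r s a
  r_le_Rmax : ∀ s a, r s a ≤ Rmax

variable {S A : Type} [Fintype S] [Fintype A]

/-- A policy assigns to each state a probability mass function over actions. -/
def IsPolicy (π : S → A → ℝ) : Prop :=
  (∀ s a, 0 ≤ π s a) ∧ ∀ s, ∑ a, π s a = 1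

/-- The `n`-step value function: `V 0 s = 0` and
`V (n+1) s = E_{a∼π(s)}[r s a + E_{s'∼P(s,a)}[V n s']]`. -/
def FinMDP.V (M : FinMDP S A) (π : S → A → ℝ) : ℕ → S → ℝ
  | 0, _ => 0
  | n + 1, s => ∑ a, π s a * (M.r s a + ∑ s', M.P s a s' * M.V π n s')

/-- The state-visitation distribution at time `t`, starting from `s₀`. -/
def FinMDP.visit [DecidableEq S] (M : FinMDP S A) (π : S → A → ℝ) (s₀ : S) : ℕ → S → ℝ
  | 0, s => if s = s₀ then 1 else 0
  | t + 1, s' => ∑ s, M.visit π s₀ t s * ∑ a, π s a * M.P s a s'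

theorem V_bounds (M : FinMDP S A) (π : S → A → ℝ) (hπ : IsPolicy π) (n : ℕ) :
    ∀ s, 0 ≤ M.V π n s ∧ M.V π n s ≤ n * M.Rmax := by
  induction n with
  | zero => intro s; simp [FinMDP.V]
  | succ n ih =>
    intro s
    have hq : ∀ a, 0 ≤ M.r s a + ∑ s', M.P s a s' * M.V π n s' ∧
        M.r s a + ∑ s', M.P s a s' * M.V π n s' ≤ (n + 1) * M.Rmax := by
      intro a
      have h1 : 0 ≤ ∑ s', M.P s a s' * M.V π n s' :=
        Finset.sum_nonneg fun s' _ => mul_nonneg (M.P_nonneg s a s') (ih s').1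
      have h2 : ∑ s', M.P s a s' * M.V π n s' ≤ ∑ s', M.P s a s' * (n * M.Rmax) :=
        Finset.sum_le_sum fun s' _ => mul_le_mul_of_nonneg_left (ih s').2 (M.P_nonneg s a s')
      rw [← Finset.sum_mul, M.P_sum, one_mul] at h2
      have h3 := M.r_nonneg s a
      have h4 := M.r_le_Rmax s a
      constructor <;> linarith
    simp only [FinMDP.V]
    refine ⟨Finset.sum_nonneg fun a _ => mul_nonneg (hπ.1 s a) (hq a).1, ?_⟩
    have h2 := Finset.sum_le_sum fun a (_ : a ∈ Finset.univ) =>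
      mul_le_mul_of_nonneg_left (hq a).2 (hπ.1 s a)
    rw [← Finset.sum_mul, hπ.2, one_mul] at h2
    push_cast
    exact h2

theorem visit_nonneg [DecidableEq S] (M : FinMDP S A) (π : S → A → ℝ) (hπ : IsPolicy π)
    (s₀ : S) (t : ℕ) : ∀ s, 0 ≤ M.visit π s₀ t s := by
  induction t with
  | zero => intro s; simp only [FinMDP.visit]; split_ifs <;> norm_num
  | succ t ih =>
    intro s
    exact Finset.sum_nonneg fun s' _ => mul_nonneg (ih s') (Finset.sum_nonneg fun a _ =>
      mul_nonneg (hπ.1 s' a) (M.P_nonneg s' a s))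

theorem step_bound (M : FinMDP S A) (πL πgc : S → A → ℝ)
    (hL : IsPolicy πL) (hgc : IsPolicy πgc)
    (α : S → ℝ) (ρ : S → A → ℝ) (hα1 : ∀ s, α s ≤ 1)
    (hρ0 : ∀ s a, 0 ≤ ρ s a)
    (hmix : ∀ s a, πgc s a = α s * πL s a + (1 - α s) * ρ s a) (n : ℕ) (s : S) :
    M.V πL (n + 1) s - M.V πgc (n + 1) s ≤
      (∑ s', (∑ a, πL s a * M.P s a s') * (M.V πL n s' - M.V πgc n s'))
        + (n + 1) * M.Rmax * (1 - α s) := by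
  have hV := V_bounds M πgc hgc n
  set W := M.V πgc n with hW
  have hq : ∀ a, 0 ≤ M.r s a + ∑ s', M.P s a s' * W s' ∧
      M.r s a + ∑ s', M.P s a s' * W s' ≤ (n + 1) * M.Rmax := by
    intro a
    have h1 : 0 ≤ ∑ s', M.P s a s' * W s' :=
      Finset.sum_nonneg fun s' _ => mul_nonneg (M.P_nonneg s a s') (hV s').1
    have h2 : ∑ s', M.P s a s' * W s' ≤ ∑ s', M.P s a s' * (n * M.Rmax) :=
      Finset.sum_le_sum fun s' _ => mul_le_mul_of_nonneg_left (hV s').2 (M.P_nonneg s a s')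
    rw [← Finset.sum_mul, M.P_sum, one_mul] at h2
    have h3 := M.r_nonneg s a
    have h4 := M.r_le_Rmax s a
    constructor <;> linarith
  have hsw : (∑ s', (∑ a, πL s a * M.P s a s') * (M.V πL n s' - W s')) =
      ∑ a, πL s a * (∑ s', M.P s a s' * M.V πL n s' - ∑ s', M.P s a s' * W s') := by
    simp_rw [Finset.sum_mul, ← Finset.sum_sub_distrib, Finset.mul_sum]
    rw [Finset.sum_comm]
    refine Finset.sum_congr rfl fun a _ => Finset.sum_congr rfl fun s' _ => by ring
  have hc : (n + 1) * M.Rmax * (1 - α s) =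
      ∑ a, πL s a * ((n + 1) * M.Rmax * (1 - α s)) := by
    rw [← Finset.sum_mul, hL.2, one_mul]
  rw [hsw, hc, ← Finset.sum_add_distrib]
  simp only [FinMDP.V]
  rw [← hW, ← Finset.sum_sub_distrib]
  refine Finset.sum_le_sum fun a _ => ?_
  rw [hmix]
  have h1 := mul_le_mul_of_nonneg_left (hq a).2
    (mul_nonneg (hL.1 s a) (sub_nonneg.2 (hα1 s)))
  have h2 := mul_nonneg (mul_nonneg (hρ0 s a) (sub_nonneg.2 (hα1 s))) (hq a).1
  linarith

theorem gap_bound [DecidableEq S] (M : FinMDP S A) (πL πgc : S → A → ℝ)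
    (hL : IsPolicy πL) (hgc : IsPolicy πgc) (hR : 0 ≤ M.Rmax)
    (α : S → ℝ) (ρ : S → A → ℝ) (hα1 : ∀ s, α s ≤ 1)
    (hρ0 : ∀ s a, 0 ≤ ρ s a)
    (hmix : ∀ s a, πgc s a = α s * πL s a + (1 - α s) * ρ s a) (s₀ : S) (n : ℕ) :
    ∀ t, ∑ s, M.visit πL s₀ t s * (M.V πL n s - M.V πgc n s) ≤
      n * M.Rmax * ∑ k ∈ Finset.range n, ∑ s, M.visit πL s₀ (t + k) s * (1 - α s) := by
  induction n with
  | zero => intro t; simp [FinMDP.V]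
  | succ n ih =>
    intro t
    have h1 := Finset.sum_le_sum fun s (_ : s ∈ Finset.univ) =>
      mul_le_mul_of_nonneg_left (step_bound M πL πgc hL hgc α ρ hα1 hρ0 hmix n s)
        (visit_nonneg M πL hL s₀ t s)
    refine h1.trans ?_
    simp_rw [mul_add, Finset.sum_add_distrib]
    have h2 : ∑ s, M.visit πL s₀ t s *
        ∑ s', (∑ a, πL s a * M.P s a s') * (M.V πL n s' - M.V πgc n s') =
        ∑ s, M.visit πL s₀ (t + 1) s * (M.V πL n s - M.V πgc n s) := by
      simp only [FinMDP.visit]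
      simp_rw [Finset.sum_mul _ _ (M.V πL n _ - M.V πgc n _), Finset.mul_sum]
      rw [Finset.sum_comm]
      simp only [Finset.sum_mul, Finset.mul_sum, mul_assoc]
    have h3 : ∑ s, M.visit πL s₀ t s * ((n + 1) * M.Rmax * (1 - α s)) =
        (n + 1) * M.Rmax * ∑ s, M.visit πL s₀ t s * (1 - α s) := by
      rw [Finset.mul_sum]
      exact Finset.sum_congr rfl fun s _ => by ring
    rw [h2, h3, Finset.sum_range_succ']
    have h4 := ih (t + 1)
    have h5 : 0 ≤ ∑ k ∈ Finset.range n, ∑ s, M.visit πL s₀ (t + 1 + k) s * (1 - α s) :=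
      Finset.sum_nonneg fun k _ => Finset.sum_nonneg fun s _ =>
        mul_nonneg (visit_nonneg M πL hL s₀ _ s) (sub_nonneg.2 (hα1 s))
    have h6 := mul_nonneg hR h5
    have h7 : ∑ k ∈ Finset.range n, ∑ s, M.visit πL s₀ (t + (k + 1)) s * (1 - α s) =
        ∑ k ∈ Finset.range n, ∑ s, M.visit πL s₀ (t + 1 + k) s * (1 - α s) :=
      Finset.sum_congr rfl fun k _ => by rw [show t + (k + 1) = t + 1 + k by ring]
    rw [h7, add_zero]
    push_cast
    linarith

/-- **Value gap controlled by executability.** If for every state `s`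
the composed policy `π_gc(·∣s)` is a mixture `α(s)·π_L(·∣s) + (1−α(s))·ρ_s` with
`α(s) ∈ [0,1]` and `ρ_s` a probability mass function on actions, then
`V_H^{π_L}(s₀) − V_H^{π_gc}(s₀) ≤ 2·H·Rmax · ∑_{t<H} E_{s∼d_{π_L,t}}[1 − α(s)]`. -/
theorem stmt_5 [DecidableEq S] (M : FinMDP S A) (πL πgc : S → A → ℝ)
    (hL : IsPolicy πL) (hgc : IsPolicy πgc)
    (α : S → ℝ) (ρ : S → A → ℝ)
    (hα0 : ∀ s, 0 ≤ α s) (hα1 : ∀ s, α s ≤ 1)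
    (hρ0 : ∀ s a, 0 ≤ ρ s a) (hρ1 : ∀ s, ∑ a, ρ s a = 1)
    (hmix : ∀ s a, πgc s a = α s * πL s a + (1 - α s) * ρ s a)
    (H : ℕ) (s₀ : S) :
    M.V πL H s₀ - M.V πgc H s₀ ≤
      2 * H * M.Rmax * ∑ t ∈ Finset.range H, ∑ s, M.visit πL s₀ t s * (1 - α s) := by
  have hA : Nonempty A := by
    by_contra h
    rw [not_nonempty_iff] at h
    have := hL.2 s₀
    simp at this
  obtain ⟨a⟩ := hA
  have hR : 0 ≤ M.Rmax := (M.r_nonneg s₀ a).trans (M.r_le_Rmax s₀ a)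
  have h := gap_bound M πL πgc hL hgc hR α ρ hα1 hρ0 hmix s₀ H 0
  simp only [zero_add] at h
  have h0 : ∑ s, M.visit πL s₀ 0 s * (M.V πL H s - M.V πgc H s) =
      M.V πL H s₀ - M.V πgc H s₀ := by
    simp [FinMDP.visit]
  rw [h0] at h
  have h5 : 0 ≤ ∑ k ∈ Finset.range H, ∑ s, M.visit πL s₀ k s * (1 - α s) :=
    Finset.sum_nonneg fun k _ => Finset.sum_nonneg fun s _ =>
      mul_nonneg (visit_nonneg M πL hL s₀ _ s) (sub_nonneg.2 (hα1 s))
  have h6 := mul_nonneg (mul_nonneg (Nat.cast_nonneg (α := ℝ) H) hR) h5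
  linarith
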